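/- Let F be a field and C₂ ⊊ C₁ ⊆ F^n nested linear codes. Then for every 1 ≤ r ≤ dim(C₁/C₂), d_{H,r}(C₁,C₂) = d_{M,r}(Δ(C₁), Δ(C₂)), and for every 0 ≤ μ ≤ n, K_{H,μ}(C₁,C₂) = K_{M,μ}(Δ(C₁), Δ(C₂)). -/

import Mathlib

noncomputable section

open Matrix

variable {F : Type*} [Field F]

/-- The row space of a matrix: the span of its rows. -/
def rowSpace {m n : ℕ} (C : Matrix (Fin m) (Fin n) F) : Submodule F (Fin n → F) :=
  Submodule.span F (Set.range C)

/-- The rank support space of a subspace `L ⊆ F^n`: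
all `m × n` matrices whose row space is contained in `L`. -/
def rss (m : ℕ) {n : ℕ} (L : Submodule F (Fin n → F)) :
    Submodule F (Matrix (Fin m) (Fin n) F) where
  carrier := {V | rowSpace V ≤ L}
  add_mem' := by
    intro a b ha hb
    simp only [Set.mem_setOf_eq, rowSpace, Submodule.span_le] at *
    rintro x ⟨i, rfl⟩
    exact L.add_mem (ha (Set.mem_range_self i)) (hb (Set.mem_range_self i))
  zero_mem' := by
    simp only [Set.mem_setOf_eq, rowSpace, Submodule.span_le]
    rintro x ⟨i, rfl⟩
    exact L.zero_mem
  smul_mem' := by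
    intro c a ha
    simp only [Set.mem_setOf_eq, rowSpace, Submodule.span_le] at *
    rintro x ⟨i, rfl⟩
    exact L.smul_mem c (ha (Set.mem_range_self i))

/-- The `r`-th relative generalized matrix weight of a pair of nested linear codes. -/
def dM {m n : ℕ} (C₁ C₂ : Submodule F (Matrix (Fin m) (Fin n) F)) (r : ℕ) : ℕ :=
  sInf { d | ∃ L : Submodule F (Fin n → F), Module.finrank F L = d ∧
    Module.finrank F ↥(C₁ ⊓ rss m L) - Module.finrank F ↥(C₂ ⊓ rss m L) ≥ r }

/-- The `μ`-th relative dimension/rank support profile of a pair of nested linear codes. -/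
def KM {m n : ℕ} (C₁ C₂ : Submodule F (Matrix (Fin m) (Fin n) F)) (μ : ℕ) : ℕ :=
  sSup { k | ∃ L : Submodule F (Fin n → F), Module.finrank F L ≤ μ ∧
    k = Module.finrank F ↥(C₁ ⊓ rss m L) - Module.finrank F ↥(C₂ ⊓ rss m L) }

/-- The diagonal representation map `Δ : F^n → F^{n×n}`, as a linear map. -/
def diagLin {n : ℕ} : (Fin n → F) →ₗ[F] Matrix (Fin n) (Fin n) F where
  toFun := Matrix.diagonal
  map_add' a b := by
    ext i j
    by_cases h : i = j <;> simp [Matrix.diagonal_apply, Matrix.add_apply, h]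
  map_smul' r a := by
    ext i j
    by_cases h : i = j <;> simp [Matrix.diagonal_apply, Matrix.smul_apply, h]

/-- The Hamming support of a subspace `D ⊆ F^n`. -/
def HSupp {n : ℕ} (D : Submodule F (Fin n → F)) : Set (Fin n) :=
  {i | ∃ c ∈ D, c i ≠ 0}

/-- The Hamming weight of a subspace `D ⊆ F^n`. -/
def wtH {n : ℕ} (D : Submodule F (Fin n → F)) : ℕ :=
  (HSupp D).ncard

/-- The Hamming support space of a subset `I ⊆ {1, …, n}`. -/
def LI {n : ℕ} (I : Set (Fin n)) : Submodule F (Fin n → F) where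
  carrier := {c | ∀ i ∉ I, c i = 0}
  add_mem' := by
    intro a b ha hb i hi
    simp [Pi.add_apply, ha i hi, hb i hi]
  zero_mem' := by
    intro i hi
    rfl
  smul_mem' := by
    intro c a ha i hi
    simp [Pi.smul_apply, ha i hi]

/-- The `r`-th relative generalized Hamming weight of a pair of nested linear codes in `F^n`. -/
def dH {n : ℕ} (C₁ C₂ : Submodule F (Fin n → F)) (r : ℕ) : ℕ :=
  sInf { c | ∃ I : Finset (Fin n), c = I.card ∧
    Module.finrank F ↥(C₁ ⊓ LI (I : Set (Fin n))) -
      Module.finrank F ↥(C₂ ⊓ LI (I : Set (Fin n))) ≥ r }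

/-- The `μ`-th relative dimension/length profile of a pair of nested linear codes in `F^n`. -/
def KH {n : ℕ} (C₁ C₂ : Submodule F (Fin n → F)) (μ : ℕ) : ℕ :=
  sSup { k | ∃ I : Finset (Fin n), I.card ≤ μ ∧
    k = Module.finrank F ↥(C₁ ⊓ LI (I : Set (Fin n))) -
      Module.finrank F ↥(C₂ ⊓ LI (I : Set (Fin n))) }

/-- The coordinates `i` whose standard basis vector lies in `L`. -/
def basisCoords {n : ℕ} (L : Submodule F (Fin n → F)) : Finset (Fin n) := by
  classical exact {i | Pi.single i 1 ∈ L}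

lemma mem_basisCoords {n : ℕ} {L : Submodule F (Fin n → F)} {i : Fin n} :
    i ∈ basisCoords L ↔ Pi.single i 1 ∈ L := by
  simp [basisCoords]

lemma mem_rss {m n : ℕ} {L : Submodule F (Fin n → F)} {V : Matrix (Fin m) (Fin n) F} :
    V ∈ rss m L ↔ ∀ i, V i ∈ L := by
  change Submodule.span F (Set.range V) ≤ L ↔ _
  exact Submodule.span_le.trans Set.range_subset_iff

lemma diagLin_injective {n : ℕ} : Function.Injective (diagLin (F := F) (n := n)) :=
  Matrix.diagonal_injective

lemma diagLin_row {n : ℕ} (c : Fin n → F) (i : Fin n) :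
    diagLin c i = c i • (Pi.single i 1 : Fin n → F) := by
  ext j
  by_cases h : i = j
  · subst h
    simp [diagLin]
  · simp [diagLin, h]

lemma diagLin_mem_rss {n : ℕ} {L : Submodule F (Fin n → F)} {c : Fin n → F} :
    diagLin c ∈ rss n L ↔ c ∈ LI (basisCoords L : Set (Fin n)) := by
  rw [mem_rss]
  change _ ↔ ∀ i ∉ (basisCoords L : Set (Fin n)), c i = 0
  refine forall_congr' fun i => ?_
  rw [diagLin_row, Finset.mem_coe, mem_basisCoords]
  by_cases h : c i = 0
  · simp [h]
  · simp [h, L.smul_mem_iff h]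

lemma finrank_map_diagLin_inf_rss {n : ℕ} (C L : Submodule F (Fin n → F)) :
    Module.finrank F ↥(Submodule.map diagLin C ⊓ rss n L) =
      Module.finrank F ↥(C ⊓ LI (basisCoords L : Set (Fin n))) := by
  have hcomap : LI (basisCoords L : Set (Fin n)) = (rss n L).comap diagLin := by
    ext c
    exact diagLin_mem_rss.symm
  rw [hcomap, Submodule.map_inf_eq_map_inf_comap]
  exact (Submodule.equivMapOfInjective diagLin diagLin_injective _).finrank_eq.symm

lemma single_mem_LI {n : ℕ} {I : Finset (Fin n)} {i : Fin n} :
    (Pi.single i 1 : Fin n → F) ∈ LI (I : Set (Fin n)) ↔ i ∈ I := by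
  change (∀ j ∉ (I : Set (Fin n)), (Pi.single i 1 : Fin n → F) j = 0) ↔ _
  simp only [Finset.mem_coe, Pi.single_apply]
  refine ⟨fun h => ?_, fun hi j hj => if_neg (by rintro rfl; exact hj hi)⟩
  by_contra hi
  simpa using h i hi

lemma basisCoords_LI {n : ℕ} (I : Finset (Fin n)) :
    basisCoords (LI (F := F) (I : Set (Fin n))) = I := by
  ext i
  rw [mem_basisCoords, single_mem_LI]

lemma LI_eq_span {n : ℕ} (I : Finset (Fin n)) :
    LI (F := F) (I : Set (Fin n)) =
      Submodule.span F (Set.range fun i : I => (Pi.single (i : Fin n) 1 : Fin n → F)) := by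
  refine le_antisymm (fun c hc => ?_) ?_
  · rw [pi_eq_sum_univ' c]
    refine Submodule.sum_mem _ fun i _ => ?_
    by_cases hi : i ∈ I
    · exact Submodule.smul_mem _ _ (Submodule.subset_span ⟨⟨i, hi⟩, rfl⟩)
    · rw [hc i hi, zero_smul]
      exact Submodule.zero_mem _
  · rw [Submodule.span_le, Set.range_subset_iff]
    exact fun i => single_mem_LI.mpr i.2

lemma finrank_LI {n : ℕ} (I : Finset (Fin n)) :
    Module.finrank F ↥(LI (F := F) (I : Set (Fin n))) = I.card := by
  have hli : LinearIndependent F fun i : I => (Pi.single (i : Fin n) 1 : Fin n → F) :=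
    (Pi.linearIndependent_single_one (Fin n) F).comp _ Subtype.val_injective
  rw [LI_eq_span, finrank_span_eq_card hli, Fintype.card_coe]

lemma LI_basisCoords_le {n : ℕ} (L : Submodule F (Fin n → F)) :
    LI (basisCoords L : Set (Fin n)) ≤ L := by
  rw [LI_eq_span, Submodule.span_le, Set.range_subset_iff]
  exact fun i => mem_basisCoords.mp i.2

lemma card_basisCoords_le {n : ℕ} (L : Submodule F (Fin n → F)) :
    (basisCoords L).card ≤ Module.finrank F L := by
  rw [← finrank_LI (F := F)]
  exact Submodule.finrank_mono (LI_basisCoords_le L)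

lemma dH_eq_dM_map_diagLin {n : ℕ} (C₁ C₂ : Submodule F (Fin n → F)) (r : ℕ) :
    dH C₁ C₂ r = dM (Submodule.map diagLin C₁) (Submodule.map diagLin C₂) r := by
  simp only [dH, dM, finrank_map_diagLin_inf_rss]
  refine csInf_eq_csInf_of_forall_exists_le ?_ ?_
  · rintro _ ⟨I, rfl, hI⟩
    exact ⟨_, ⟨LI I, rfl, by rwa [basisCoords_LI]⟩, (finrank_LI I).le⟩
  · rintro _ ⟨L, rfl, hL⟩
    exact ⟨_, ⟨basisCoords L, rfl, hL⟩, card_basisCoords_le L⟩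

lemma KH_eq_KM_map_diagLin {n : ℕ} (C₁ C₂ : Submodule F (Fin n → F)) (μ : ℕ) :
    KH C₁ C₂ μ = KM (Submodule.map diagLin C₁) (Submodule.map diagLin C₂) μ := by
  simp only [KH, KM, finrank_map_diagLin_inf_rss]
  congr 1
  ext k
  constructor
  · rintro ⟨I, hI, rfl⟩
    exact ⟨LI I, (finrank_LI I).trans_le hI, by rw [basisCoords_LI]⟩
  · rintro ⟨L, hL, rfl⟩
    exact ⟨basisCoords L, (card_basisCoords_le L).trans hL, rfl⟩

/-- RGMWs and RDRPs extend RGHWs and RDLPs: for nested linear codes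
`C₂ ⊊ C₁ ⊆ F^n`, `d_{H,r}(C₁,C₂) = d_{M,r}(Δ(C₁), Δ(C₂))` for `1 ≤ r ≤ dim(C₁/C₂)` and
`K_{H,μ}(C₁,C₂) = K_{M,μ}(Δ(C₁), Δ(C₂))` for `0 ≤ μ ≤ n`. -/
theorem stmt_19 (n : ℕ) (C₁ C₂ : Submodule F (Fin n → F)) (h21 : C₂ ≤ C₁) (hne : C₂ ≠ C₁) :
    (∀ r : ℕ, 1 ≤ r → r ≤ Module.finrank F ↥C₁ - Module.finrank F ↥C₂ →
      dH C₁ C₂ r = dM (Submodule.map (diagLin (F := F) (n := n)) C₁)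
        (Submodule.map (diagLin (F := F) (n := n)) C₂) r) ∧
    (∀ μ : ℕ, μ ≤ n →
      KH C₁ C₂ μ = KM (Submodule.map (diagLin (F := F) (n := n)) C₁)
        (Submodule.map (diagLin (F := F) (n := n)) C₂) μ) := by
  exact ⟨fun r _ _ => dH_eq_dM_map_diagLin C₁ C₂ r, fun μ _ => KH_eq_KM_map_diagLin C₁ C₂ μ⟩

end
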